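/- Let m ≥ 1 be an integer. For τ in the upper half-plane ℍ write q^r := e^{2πirτ} for r ∈ ℚ, and define η(τ) = q^{1/24}∏_{n≥1}(1−q^n), 𝔣(τ) = q^{−1/48}∏_{n≥1}(1+q^{n−1/2}), and for j ∈ ℤ define Θ_j(τ) = ∑_{n∈ℤ} q^{((2m+1)n+j)²/(2(2m+1))} and D_j(τ) = ∑_{n∈ℤ} ((2m+1)n+j)·q^{((2m+1)n+j)²/(2(2m+1))}. Consider the 3m+1 functions on ℍ: F₀ = (𝔣/η)·Θ₀; for i = 0,…,m−1, A_i = (𝔣/η)·( ((2i+1)/(2m+1))·Θ_{m−i} + (2/(2m+1))·D_{m−i} ), B_i = (𝔣/η)·( ((2m−2i)/(2m+1))·Θ_{m−i} − (2/(2m+1))·D_{m−i} ), and C_i(τ) = τ·(𝔣(τ)/η(τ))·D_{m−i}(τ). Then these 3m+1 functions are linearly independent over ℂ, and their complex linear span is invariant under the two operations F(τ) ↦ F(−1/τ) and F(τ) ↦ F(τ+2); in particular the span is a (3m+1)-dimensional Γ_θ-invariant space, where Γ_θ ⊂ SL(2,ℤ) is the subgroup generated by S: τ↦−1/τ and T²: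 τ↦τ+2. -/

import Mathlib

open scoped UpperHalfPlane

/-- `q^r := e^{2πirτ}` for `r ∈ ℚ` and `τ` in the upper half-plane. -/
noncomputable def qpow (r : ℚ) (τ : UpperHalfPlane) : ℂ :=
  Complex.exp (2 * Real.pi * Complex.I * (r : ℂ) * (τ : ℂ))

/-- Dedekind eta function `η(τ) = q^{1/24} ∏_{n≥1} (1 - q^n)`. -/
noncomputable def etaF (τ : ℍ) : ℂ :=
  qpow (1 / 24) τ * ∏' n : ℕ, (1 - qpow ((n : ℚ) + 1) τ)

/-- Weber function `𝔣(τ) = q^{-1/48} ∏_{n≥1} (1 + q^{n-1/2})`. -/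
noncomputable def webF (τ : ℍ) : ℂ :=
  qpow (-(1 / 48)) τ * ∏' n : ℕ, (1 + qpow ((n : ℚ) + 1 / 2) τ)

/-- Theta series `Θ_j(τ) = ∑_{n∈ℤ} q^{((2m+1)n+j)²/(2(2m+1))}`. -/
noncomputable def ThetaF (m : ℕ) (j : ℤ) (τ : ℍ) : ℂ :=
  ∑' n : ℤ, qpow (((2 * (m : ℚ) + 1) * (n : ℚ) + (j : ℚ)) ^ 2 / (2 * (2 * (m : ℚ) + 1))) τ

/-- Derivative theta series `D_j(τ) = ∑_{n∈ℤ} ((2m+1)n+j) q^{((2m+1)n+j)²/(2(2m+1))}`. -/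
noncomputable def DThetaF (m : ℕ) (j : ℤ) (τ : ℍ) : ℂ :=
  ∑' n : ℤ, (((2 * (m : ℤ) + 1) * n + j : ℤ) : ℂ)
    * qpow (((2 * (m : ℚ) + 1) * (n : ℚ) + (j : ℚ)) ^ 2 / (2 * (2 * (m : ℚ) + 1))) τ

/-- The family of `3m+1` functions on `ℍ`: the character of `SΛ(m+1)`, the characters of
`SΛ(i+1)` and of `SΠ(m-i)` for `0 ≤ i ≤ m-1`, and the `m` pseudocharacters
`τ·(𝔣/η)·(∂Θ)_{m-i,(2m+1)/2}`. -/
noncomputable def fam (m : ℕ) : Unit ⊕ Fin m ⊕ Fin m ⊕ Fin m → ℍ → ℂ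
  | Sum.inl _ => fun τ => webF τ / etaF τ * ThetaF m 0 τ
  | Sum.inr (Sum.inl i) => fun τ => webF τ / etaF τ *
      (((2 * ((i : ℕ) : ℂ) + 1) / (2 * (m : ℂ) + 1)) * ThetaF m ((m : ℤ) - (i : ℕ)) τ
        + (2 / (2 * (m : ℂ) + 1)) * DThetaF m ((m : ℤ) - (i : ℕ)) τ)
  | Sum.inr (Sum.inr (Sum.inl i)) => fun τ => webF τ / etaF τ *
      (((2 * (m : ℂ) - 2 * ((i : ℕ) : ℂ)) / (2 * (m : ℂ) + 1)) * ThetaF m ((m : ℤ) - (i : ℕ)) τ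
        - (2 / (2 * (m : ℂ) + 1)) * DThetaF m ((m : ℤ) - (i : ℕ)) τ)
  | Sum.inr (Sum.inr (Sum.inr i)) => fun τ =>
      (τ : ℂ) * (webF τ / etaF τ) * DThetaF m ((m : ℤ) - (i : ℕ)) τ

theorem hasSum_pow_eq_zero {v : ℕ → ℂ} {e : ℕ → ℕ} (he : StrictMono e)
    (h : ∀ x : ℝ, 0 < x → x < 1 → HasSum (fun n => v n * (x : ℂ) ^ e n) 0) (n : ℕ) : v n = 0 := by
  induction n using Nat.strong_induction_on with
  | _ K ih =>
  have h0 (x : ℝ) (hx : 0 < x) (hx1 : x < 1) :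
      HasSum (fun n => v n * (x : ℂ) ^ (e n - e K)) 0 := by
    have := (h x hx hx1).mul_left (((x : ℂ) ^ e K)⁻¹)
    rw [mul_zero] at this
    have hfun : (fun n => v n * (x : ℂ) ^ (e n - e K)) =
        fun n => ((x : ℂ) ^ e K)⁻¹ * (v n * (x : ℂ) ^ e n) := by
      funext n
      rcases lt_or_ge n K with hn | hn
      · simp [ih n hn]
      · have hxc : (x : ℂ) ≠ 0 := by exact_mod_cast hx.ne'
        rw [pow_sub₀ _ hxc (he.monotone hn)]
        ring
    rwa [hfun]
  have hlim : Filter.Tendsto (fun x : ℝ => ∑' n, v n * (x : ℂ) ^ (e n - e K))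
      (nhdsWithin 0 (Set.Ioi 0)) (nhds (∑' n, if n = K then v K else 0)) := by
    refine tendsto_tsum_of_dominated_convergence
      (bound := fun n => ‖v n * ((1 / 2 : ℝ) : ℂ) ^ (e n - e K)‖)
      (h0 (1 / 2) (by norm_num) (by norm_num)).summable.norm (fun n => ?_) ?_
    · rcases lt_trichotomy n K with hn | rfl | hn
      · simp [ih n hn, hn.ne]
      · simp
      · have hne : e n - e K ≠ 0 := by have := he hn; omega
        have hc : Continuous fun x : ℝ => v n * (x : ℂ) ^ (e n - e K) := by fun_prop
        have := hc.tendsto 0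
        simp only [Complex.ofReal_zero, zero_pow hne, mul_zero] at this
        rw [if_neg hn.ne']
        exact this.mono_left nhdsWithin_le_nhds
    · filter_upwards [Ioo_mem_nhdsGT (show (0 : ℝ) < 1 / 2 by norm_num)] with x hx n
      rw [norm_mul, norm_mul, norm_pow, norm_pow, Complex.norm_real, Complex.norm_real,
        Real.norm_of_nonneg hx.1.le, Real.norm_of_nonneg (by norm_num : (0 : ℝ) ≤ 1 / 2)]
      gcongr
      · exact hx.1.le
      · exact hx.2.le
  have hz : Filter.Tendsto (fun x : ℝ => ∑' n, v n * (x : ℂ) ^ (e n - e K))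
      (nhdsWithin 0 (Set.Ioi 0)) (nhds 0) := by
    refine tendsto_const_nhds.congr' ?_
    filter_upwards [Ioo_mem_nhdsGT (show (0 : ℝ) < 1 by norm_num)] with x hx
    exact (h0 x hx.1 hx.2).tsum_eq.symm
  simpa using tendsto_nhds_unique hlim hz

theorem eta_neg_one_div (τ : ℍ) : ModularForm.eta (-1 / (τ : ℂ)) =
    (-Complex.I * τ) ^ (1 / 2 : ℂ) * ModularForm.eta τ := by
  have h := ModularForm.eta_comp_eq_csqrt_I_inv τ.2
  simp only [Function.comp_apply, Pi.smul_apply, Pi.mul_apply, smul_eq_mul] at h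
  rw [h, ← mul_assoc]
  congr 1
  have hI := Complex.I_ne_zero
  have hy : -Complex.I * (τ : ℂ) ≠ 0 := mul_ne_zero (neg_ne_zero.2 hI) τ.ne_zero
  have harg := Complex.abs_arg_lt_pi_div_two_iff.2
    (Or.inl (show 0 < (-Complex.I * (τ : ℂ)).re by simpa using τ.im_pos))
  rw [abs_lt] at harg
  have hlog := Complex.log_mul hI hy (by
    rw [Complex.arg_I]; constructor <;> linarith [Real.pi_pos])
  rw [show Complex.I * (-Complex.I * (τ : ℂ)) = τ by
    linear_combination (-(τ : ℂ)) * Complex.I_mul_I] at hlog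
  rw [Complex.sqrt, Complex.sqrt, Complex.cpow_def_of_ne_zero hI,
    Complex.cpow_def_of_ne_zero τ.ne_zero, hlog, ← Complex.exp_neg,
    ← Complex.exp_add, Complex.cpow_def_of_ne_zero hy]
  congr 1
  ring

theorem etaF_eq (τ : ℍ) : etaF τ = ModularForm.eta τ := by
  unfold etaF ModularForm.eta qpow
  congr 1
  · rw [Function.Periodic.qParam]; congr 1; push_cast; ring
  · refine tprod_congr fun n => ?_
    rw [ModularForm.eta_q_eq_cexp]
    push_cast
    rfl

theorem etaF_ne_zero (τ : ℍ) : etaF τ ≠ 0 := by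
  rw [etaF_eq]; exact ModularForm.eta_ne_zero τ.2

theorem multipliable_one_add_pow {x : ℂ} (hx : ‖x‖ < 1) {e : ℕ → ℕ} (he : ∀ n, n ≤ e n) (c : ℂ) :
    Multipliable fun n : ℕ => 1 + c * x ^ e n := by
  apply multipliable_one_add_of_summable
  refine ((summable_geometric_of_lt_one (norm_nonneg _) hx).mul_left ‖c‖).of_nonneg_of_le
    (fun _ => norm_nonneg _) fun n => ?_
  rw [norm_mul, norm_pow]
  refine mul_le_mul_of_nonneg_left ?_ (norm_nonneg _)
  exact pow_le_pow_of_le_one (norm_nonneg _) hx.le (he n)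

theorem tprod_one_add_odd_pow {x : ℂ} (hx : ‖x‖ < 1) :
    (∏' n : ℕ, (1 + x ^ (2 * n + 1))) * (∏' n : ℕ, (1 - x ^ (n + 1))) *
      (∏' n : ℕ, (1 - x ^ (4 * (n + 1)))) = (∏' n : ℕ, (1 - x ^ (2 * (n + 1)))) ^ 2 := by
  have hm (e : ℕ → ℕ) (he : ∀ n, n ≤ e n) : Multipliable fun n : ℕ => 1 - x ^ e n := by
    simpa [sub_eq_add_neg] using multipliable_one_add_pow hx he (-1)
  have h1 : (∏' n : ℕ, (1 - x ^ (2 * n + 1))) * (∏' n : ℕ, (1 - x ^ (2 * (n + 1)))) =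
      ∏' n : ℕ, (1 - x ^ (n + 1)) := by
    rw [← tprod_even_mul_odd (f := fun n : ℕ => 1 - x ^ (n + 1)) (hm _ (by grind))
      (hm _ (by grind))]
    rfl
  have h2 : (∏' n : ℕ, (1 - x ^ (4 * n + 2))) * (∏' n : ℕ, (1 - x ^ (4 * (n + 1)))) =
      ∏' n : ℕ, (1 - x ^ (2 * (n + 1))) := by
    rw [← tprod_even_mul_odd (f := fun n : ℕ => 1 - x ^ (2 * (n + 1))) (hm _ (by grind))
      (hm _ (by grind))]
    refine congrArg₂ _ (tprod_congr fun n => ?_) (tprod_congr fun n => ?_) <;> ring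
  have h3 : (∏' n : ℕ, (1 + x ^ (2 * n + 1))) * (∏' n : ℕ, (1 - x ^ (2 * n + 1))) =
      ∏' n : ℕ, (1 - x ^ (4 * n + 2)) := by
    rw [← Multipliable.tprod_mul (by simpa using multipliable_one_add_pow hx (by grind) 1)
      (hm _ (by grind))]
    exact tprod_congr fun n => by ring
  rw [← h1, sq]
  nth_rewrite 2 [← h2]
  rw [← h3]
  ring

theorem webF_mul_eta (τ : ℍ) :
    webF τ * ModularForm.eta (τ / 2) * ModularForm.eta (2 * τ) = etaF τ ^ 2 := by
  have key := tprod_one_add_odd_pow (x := Complex.exp (Real.pi * Complex.I * τ)) (by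
    rw [Complex.norm_exp]
    simpa using mul_pos Real.pi_pos τ.im_pos)
  unfold webF etaF ModularForm.eta qpow
  simp only [ModularForm.eta_q_eq_cexp, ← Complex.exp_nat_mul] at key ⊢
  have e1 (n : ℕ) : Complex.exp (2 * Real.pi * Complex.I * (((n : ℚ) + 1 / 2 : ℚ) : ℂ) * τ) =
      Complex.exp ((2 * n + 1 : ℕ) * (Real.pi * Complex.I * τ)) := by
    congr 1; push_cast; ring
  have e2 (n : ℕ) : Complex.exp (2 * Real.pi * Complex.I * (((n : ℚ) + 1 : ℚ) : ℂ) * τ) =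
      Complex.exp ((2 * (n + 1) : ℕ) * (Real.pi * Complex.I * τ)) := by
    congr 1; push_cast; ring
  have e3 (n : ℕ) : Complex.exp (2 * Real.pi * Complex.I * ((n : ℂ) + 1) * (τ / 2)) =
      Complex.exp ((n + 1 : ℕ) * (Real.pi * Complex.I * τ)) := by
    congr 1; push_cast; ring
  have e4 (n : ℕ) : Complex.exp (2 * Real.pi * Complex.I * ((n : ℂ) + 1) * (2 * τ)) =
      Complex.exp ((4 * (n + 1) : ℕ) * (Real.pi * Complex.I * τ)) := by
    congr 1; push_cast; ring
  simp only [e1, e2, e3, e4]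
  rw [mul_pow, ← key]
  have e5 : Complex.exp (2 * Real.pi * Complex.I * ((-(1 / 48) : ℚ) : ℂ) * τ) *
      Function.Periodic.qParam 24 (τ / 2) * Function.Periodic.qParam 24 (2 * τ) =
      Complex.exp (2 * Real.pi * Complex.I * ((1 / 24 : ℚ) : ℂ) * τ) ^ 2 := by
    rw [Function.Periodic.qParam, Function.Periodic.qParam, ← Complex.exp_add, ← Complex.exp_add,
      ← Complex.exp_nat_mul]
    congr 1
    push_cast
    ring
  rw [← e5]
  ring

theorem coe_S_smul (τ : ℍ) : ((ModularGroup.S • τ : ℍ) : ℂ) = -1 / τ := by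
  rw [UpperHalfPlane.modular_S_smul]
  simp [neg_div, inv_neg]

theorem S_smul_S_smul (τ : ℍ) : ModularGroup.S • ModularGroup.S • τ = τ := by
  apply UpperHalfPlane.ext
  rw [coe_S_smul, coe_S_smul]
  have := τ.ne_zero
  field_simp

theorem etaF_S_smul (τ : ℍ) :
    etaF (ModularGroup.S • τ) = (-Complex.I * τ) ^ (1 / 2 : ℂ) * etaF τ := by
  rw [etaF_eq, etaF_eq, coe_S_smul, eta_neg_one_div]

theorem ofReal_mul_cpow {r : ℝ} (hr : 0 < r) (z s : ℂ) :
    ((r : ℂ) * z) ^ s = (r : ℂ) ^ s * z ^ s := by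
  rcases eq_or_ne z 0 with rfl | hz
  · rcases eq_or_ne s 0 with rfl | hs
    · simp
    · simp [hs]
  · have hr' : (r : ℂ) ≠ 0 := by exact_mod_cast hr.ne'
    rw [Complex.cpow_def_of_ne_zero (mul_ne_zero hr' hz), Complex.cpow_def_of_ne_zero hr',
      Complex.cpow_def_of_ne_zero hz, Complex.log_ofReal_mul hr hz, ← Complex.ofReal_log hr.le,
      ← Complex.exp_add, add_mul]

theorem webF_S_smul (τ : ℍ) : webF (ModularGroup.S • τ) = webF τ := by
  have h1 := webF_mul_eta τ
  have h2 := webF_mul_eta (ModularGroup.S • τ)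
  obtain ⟨σ, hσ⟩ : ∃ σ : ℍ, (σ : ℂ) = 2 * τ := ⟨⟨2 * τ, by simpa using τ.im_pos⟩, rfl⟩
  obtain ⟨ρ, hρ⟩ : ∃ ρ : ℍ, (ρ : ℂ) = τ / 2 := ⟨⟨τ / 2, by simpa using τ.im_pos⟩, rfl⟩
  have e1 : -1 / (τ : ℂ) / 2 = -1 / σ := by rw [hσ]; ring
  have e2 : 2 * (-1 / (τ : ℂ)) = -1 / ρ := by
    rw [hρ]
    have := τ.ne_zero
    field_simp
  have c1 : (-Complex.I * (σ : ℂ)) ^ (1 / 2 : ℂ) =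
      ((2 : ℝ) : ℂ) ^ (1 / 2 : ℂ) * (-Complex.I * (τ : ℂ)) ^ (1 / 2 : ℂ) := by
    rw [← ofReal_mul_cpow two_pos, hσ]
    congr 1
    push_cast
    ring
  have c2 : (-Complex.I * (τ : ℂ)) ^ (1 / 2 : ℂ) =
      ((2 : ℝ) : ℂ) ^ (1 / 2 : ℂ) * (-Complex.I * (ρ : ℂ)) ^ (1 / 2 : ℂ) := by
    rw [← ofReal_mul_cpow two_pos, hρ]
    congr 1
    push_cast
    ring
  rw [coe_S_smul, e1, e2, eta_neg_one_div, eta_neg_one_div, etaF_S_smul, c1, c2, mul_pow, ← h1,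
    hσ, hρ] at h2
  have n1 : ModularForm.eta (2 * τ) ≠ 0 := hσ ▸ ModularForm.eta_ne_zero σ.2
  have n2 : ModularForm.eta (τ / 2) ≠ 0 := hρ ▸ ModularForm.eta_ne_zero ρ.2
  have n3 : ((2 : ℝ) : ℂ) ^ (1 / 2 : ℂ) ≠ 0 := by simp [Complex.cpow_eq_zero_iff]
  have n4 : (-Complex.I * (ρ : ℂ)) ^ (1 / 2 : ℂ) ≠ 0 := by
    simp [Complex.cpow_eq_zero_iff, ρ.ne_zero]
  refine mul_right_cancel₀ (mul_ne_zero (mul_ne_zero n1 n2) (mul_ne_zero (pow_ne_zero 2 n3)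
    (pow_ne_zero 2 n4))) ?_
  rw [hρ]
  linear_combination h2

theorem webF_ne_zero (τ : ℍ) : webF τ ≠ 0 := by
  intro h
  have := webF_mul_eta τ
  rw [h, zero_mul, zero_mul] at this
  exact pow_ne_zero 2 (etaF_ne_zero τ) this.symm

theorem qpow_two_vadd (r : ℚ) (τ : ℍ) :
    qpow r ((2 : ℝ) +ᵥ τ) = Complex.exp (4 * Real.pi * Complex.I * r) * qpow r τ := by
  rw [qpow, qpow, UpperHalfPlane.coe_vadd, ← Complex.exp_add]
  congr 1
  push_cast
  ring

theorem qpow_two_vadd_of_int {r : ℚ} (k : ℤ) (h : 2 * r = k) (τ : ℍ) :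
    qpow r ((2 : ℝ) +ᵥ τ) = qpow r τ := by
  have h' : (2 : ℂ) * r = k := by exact_mod_cast congrArg (fun x : ℚ => (x : ℂ)) h
  rw [qpow_two_vadd, show 4 * Real.pi * Complex.I * (r : ℂ) = k * (2 * Real.pi * Complex.I) by
    linear_combination 2 * Real.pi * Complex.I * h', Complex.exp_int_mul_two_pi_mul_I, one_mul]

theorem webF_div_etaF_two_vadd (τ : ℍ) : webF ((2 : ℝ) +ᵥ τ) / etaF ((2 : ℝ) +ᵥ τ) =
    Complex.exp (-(Real.pi * Complex.I / 4)) * (webF τ / etaF τ) := by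
  have h1 (n : ℕ) := qpow_two_vadd_of_int (r := (n : ℚ) + 1) (2 * n + 2) (by push_cast; ring) τ
  have h2 (n : ℕ) := qpow_two_vadd_of_int (r := (n : ℚ) + 1 / 2) (2 * n + 1) (by push_cast; ring) τ
  have h3 : Complex.exp (4 * Real.pi * Complex.I * ((-(1 / 48) : ℚ) : ℂ)) =
      Complex.exp (-(Real.pi * Complex.I / 4)) *
        Complex.exp (4 * Real.pi * Complex.I * ((1 / 24 : ℚ) : ℂ)) := by
    rw [← Complex.exp_add]
    congr 1
    push_cast
    ring
  have aux (c d a p b r : ℂ) (hd : d ≠ 0) :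
      c * d * a * p / (d * b * r) = c * (a * p / (b * r)) := by
    rw [← mul_div_assoc, ← mul_div_mul_left _ (b * r) hd]
    congr 1 <;> ring
  simp only [webF, etaF, h1, h2]
  rw [qpow_two_vadd, qpow_two_vadd, h3]
  have := Complex.exp_ne_zero (4 * Real.pi * Complex.I * ((1 / 24 : ℚ) : ℂ))
  exact aux _ _ _ _ _ _ this

/-- The term `q^{k²/(2(2m+1))}` of the theta series. -/
noncomputable def sqTerm (m : ℕ) (τ : ℂ) (k : ℤ) : ℂ :=
  Complex.exp (Real.pi * Complex.I * k ^ 2 / (2 * m + 1) * τ)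

theorem two_mul_add_one_ne_zero (m : ℕ) : (2 * (m : ℂ) + 1) ≠ 0 := by
  exact_mod_cast (by omega : 2 * m + 1 ≠ 0)

theorem qpow_eq_sqTerm (m : ℕ) (j n : ℤ) (τ : ℍ) :
    qpow (((2 * (m : ℚ) + 1) * (n : ℚ) + (j : ℚ)) ^ 2 / (2 * (2 * (m : ℚ) + 1))) τ =
      sqTerm m τ ((2 * m + 1) * n + j) := by
  have := two_mul_add_one_ne_zero m
  rw [qpow, sqTerm]
  congr 1
  push_cast
  field_simp

theorem ThetaF_eq (m : ℕ) (j : ℤ) (τ : ℍ) :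
    ThetaF m j τ = ∑' n : ℤ, sqTerm m τ ((2 * m + 1) * n + j) := by
  simp only [ThetaF, qpow_eq_sqTerm]

theorem DThetaF_eq (m : ℕ) (j : ℤ) (τ : ℍ) : DThetaF m j τ =
    ∑' n : ℤ, (((2 * m + 1) * n + j : ℤ) : ℂ) * sqTerm m τ ((2 * m + 1) * n + j) := by
  simp only [DThetaF, qpow_eq_sqTerm]

theorem jacobiTheta₂_term_div (m : ℕ) (j k : ℤ) (τ : ℂ) :
    jacobiTheta₂_term k (j / (2 * m + 1)) (τ / (2 * m + 1)) =
      Complex.exp (2 * Real.pi * Complex.I * (j * k / (2 * m + 1))) * sqTerm m τ k := by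
  rw [jacobiTheta₂_term, sqTerm, ← Complex.exp_add]
  congr 1
  ring

theorem im_div_pos (m : ℕ) (τ : ℍ) : 0 < ((τ : ℂ) / (2 * m + 1)).im := by
  rw [show (2 * (m : ℂ) + 1) = ((2 * m + 1 : ℝ) : ℂ) by push_cast; ring, Complex.div_ofReal_im]
  exact div_pos τ.im_pos (by positivity)

theorem summable_exp_mul_sqTerm (m : ℕ) (j : ℤ) (τ : ℍ) : Summable fun k : ℤ =>
    Complex.exp (2 * Real.pi * Complex.I * (j * k / (2 * m + 1))) * sqTerm m τ k := by
  have := (summable_jacobiTheta₂_term_iff (j / (2 * m + 1)) (τ / (2 * m + 1))).2 (im_div_pos m τ)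
  simpa only [jacobiTheta₂_term_div] using this

theorem summable_exp_mul_mul_sqTerm (m : ℕ) (j : ℤ) (τ : ℍ) : Summable fun k : ℤ =>
    Complex.exp (2 * Real.pi * Complex.I * (j * k / (2 * m + 1))) * (k * sqTerm m τ k) := by
  have := ((summable_jacobiTheta₂'_term_iff (j / (2 * m + 1)) (τ / (2 * m + 1))).2
    (im_div_pos m τ)).mul_left (2 * Real.pi * Complex.I)⁻¹
  refine this.congr fun k => ?_
  rw [jacobiTheta₂'_term, jacobiTheta₂_term_div]
  have := Complex.two_pi_I_ne_zero
  field_simp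

theorem summable_sqTerm (m : ℕ) (τ : ℍ) : Summable (sqTerm m τ) := by
  simpa using summable_exp_mul_sqTerm m 0 τ

theorem summable_mul_sqTerm (m : ℕ) (τ : ℍ) : Summable fun k : ℤ => k * sqTerm m τ k := by
  simpa using summable_exp_mul_mul_sqTerm m 0 τ

theorem tsum_int_eq_sum_residues (N : ℕ) [NeZero N] {F : ℤ → ℂ} (hF : Summable F) :
    ∑' k, F k = ∑ r ∈ Finset.range N, ∑' n : ℤ, F (N * n + r) := by
  rw [← (Int.divModEquiv N).symm.tsum_eq,
    ← (Equiv.prodComm (Fin N) ℤ).tsum_eq]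
  have hs : Summable fun p : Fin N × ℤ =>
      F ((Int.divModEquiv N).symm (Equiv.prodComm (Fin N) ℤ p)) :=
    hF.comp_injective ((Int.divModEquiv N).symm.injective.comp (Equiv.injective _))
  rw [hs.tsum_prod, tsum_fintype, Finset.sum_range]
  simp [Int.divModEquiv_symm_apply, mul_comm]

theorem exp_residue (m : ℕ) (j r n : ℤ) :
    Complex.exp (2 * Real.pi * Complex.I *
      (j * (((2 * m + 1) * n + r : ℤ) : ℂ) / (2 * m + 1))) =
      Complex.exp (2 * Real.pi * Complex.I * (j * r / (2 * m + 1))) := by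
  have := two_mul_add_one_ne_zero m
  rw [show 2 * Real.pi * Complex.I * (j * (((2 * m + 1) * n + r : ℤ) : ℂ) / (2 * m + 1)) =
    2 * Real.pi * Complex.I * (j * r / (2 * m + 1)) + (j * n : ℤ) * (2 * Real.pi * Complex.I) by
      push_cast; field_simp; ring,
    Complex.exp_add, Complex.exp_int_mul_two_pi_mul_I, mul_one]

theorem tsum_exp_mul_sqTerm (m : ℕ) (j : ℤ) (τ : ℍ) :
    ∑' k : ℤ, Complex.exp (2 * Real.pi * Complex.I * (j * k / (2 * m + 1))) * sqTerm m τ k =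
      ∑ r ∈ Finset.range (2 * m + 1),
        Complex.exp (2 * Real.pi * Complex.I * (j * r / (2 * m + 1))) * ThetaF m r τ := by
  rw [tsum_int_eq_sum_residues (2 * m + 1) (summable_exp_mul_sqTerm m j τ)]
  refine Finset.sum_congr rfl fun r _ => ?_
  rw [ThetaF_eq, ← tsum_mul_left]
  refine tsum_congr fun n => ?_
  have := exp_residue m j r n
  push_cast at this ⊢
  rw [this]

theorem tsum_exp_mul_mul_sqTerm (m : ℕ) (j : ℤ) (τ : ℍ) :
    ∑' k : ℤ, Complex.exp (2 * Real.pi * Complex.I * (j * k / (2 * m + 1))) *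
        (k * sqTerm m τ k) =
      ∑ r ∈ Finset.range (2 * m + 1),
        Complex.exp (2 * Real.pi * Complex.I * (j * r / (2 * m + 1))) * DThetaF m r τ := by
  rw [tsum_int_eq_sum_residues (2 * m + 1) (summable_exp_mul_mul_sqTerm m j τ)]
  refine Finset.sum_congr rfl fun r _ => ?_
  rw [DThetaF_eq, ← tsum_mul_left]
  refine tsum_congr fun n => ?_
  have := exp_residue m j r n
  push_cast at this ⊢
  rw [this]

theorem sqTerm_residue (m : ℕ) (j n : ℤ) (τ : ℂ) : sqTerm m τ ((2 * m + 1) * n + j) =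
    Complex.exp (Real.pi * Complex.I * j ^ 2 / (2 * m + 1) * τ) *
      jacobiTheta₂_term n (j * τ) ((2 * m + 1) * τ) := by
  have := two_mul_add_one_ne_zero m
  rw [sqTerm, jacobiTheta₂_term, ← Complex.exp_add]
  congr 1
  push_cast
  field_simp
  ring

theorem im_mul_pos (m : ℕ) (τ : ℍ) : 0 < ((2 * m + 1) * (τ : ℂ)).im := by
  rw [show (2 * (m : ℂ) + 1) = ((2 * m + 1 : ℝ) : ℂ) by push_cast; ring, Complex.im_ofReal_mul]
  exact mul_pos (by positivity) τ.im_pos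

theorem ThetaF_eq_jacobiTheta₂ (m : ℕ) (j : ℤ) (τ : ℍ) : ThetaF m j τ =
    Complex.exp (Real.pi * Complex.I * j ^ 2 / (2 * m + 1) * τ) *
      jacobiTheta₂ (j * τ) ((2 * m + 1) * τ) := by
  rw [ThetaF_eq, jacobiTheta₂, ← tsum_mul_left]
  exact tsum_congr fun n => sqTerm_residue m j n τ

theorem DThetaF_eq_jacobiTheta₂ (m : ℕ) (j : ℤ) (τ : ℍ) : DThetaF m j τ =
    Complex.exp (Real.pi * Complex.I * j ^ 2 / (2 * m + 1) * τ) *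
      ((2 * m + 1) / (2 * Real.pi * Complex.I) * jacobiTheta₂' (j * τ) ((2 * m + 1) * τ) +
        j * jacobiTheta₂ (j * τ) ((2 * m + 1) * τ)) := by
  have h1 := (summable_jacobiTheta₂_term_iff (j * τ) ((2 * m + 1) * τ)).2 (im_mul_pos m τ)
  have h2 := (summable_jacobiTheta₂'_term_iff (j * τ) ((2 * m + 1) * τ)).2 (im_mul_pos m τ)
  rw [DThetaF_eq, jacobiTheta₂, jacobiTheta₂', ← tsum_mul_left, ← tsum_mul_left,
    ← (h2.mul_left _).tsum_add (h1.mul_left _), ← tsum_mul_left]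
  refine tsum_congr fun n => ?_
  rw [sqTerm_residue, jacobiTheta₂'_term]
  have := Complex.two_pi_I_ne_zero
  push_cast
  field_simp

theorem ThetaF_eq_sum (m : ℕ) (j : ℤ) (τ : ℍ) : ThetaF m j τ =
    1 / (-Complex.I * ((2 * m + 1) * τ)) ^ (1 / 2 : ℂ) * ∑ r ∈ Finset.range (2 * m + 1),
      Complex.exp (2 * Real.pi * Complex.I * (j * r / (2 * m + 1))) *
        ThetaF m r (ModularGroup.S • τ) := by
  have hN := two_mul_add_one_ne_zero m
  have hτ := τ.ne_zero
  rw [← tsum_exp_mul_sqTerm, ThetaF_eq_jacobiTheta₂, jacobiTheta₂_functional_equation]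
  simp only [← jacobiTheta₂_term_div]
  rw [coe_S_smul, show (j * (τ : ℂ)) / ((2 * m + 1) * τ) = j / (2 * m + 1) by field_simp,
    show -1 / ((2 * m + 1) * (τ : ℂ)) = -1 / τ / (2 * m + 1) by field_simp, ← jacobiTheta₂]
  have he : Complex.exp (Real.pi * Complex.I * j ^ 2 / (2 * m + 1) * τ) *
      Complex.exp (-Real.pi * Complex.I * (j * τ) ^ 2 / ((2 * m + 1) * τ)) = 1 := by
    rw [← Complex.exp_add, ← Complex.exp_zero]
    congr 1
    field_simp
    ring
  rw [mul_comm (1 / _) (Complex.exp _), mul_assoc (Complex.exp _) (1 / _),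
    ← mul_assoc (Complex.exp _), he, one_mul]

theorem DThetaF_eq_sum (m : ℕ) (j : ℤ) (τ : ℍ) : DThetaF m j τ =
    1 / (-Complex.I * ((2 * m + 1) * τ)) ^ (1 / 2 : ℂ) / τ * ∑ r ∈ Finset.range (2 * m + 1),
      Complex.exp (2 * Real.pi * Complex.I * (j * r / (2 * m + 1))) *
        DThetaF m r (ModularGroup.S • τ) := by
  have hN := two_mul_add_one_ne_zero m
  have hτ := τ.ne_zero
  have hpi := Complex.two_pi_I_ne_zero
  have hs : ∑' k : ℤ, Complex.exp (2 * Real.pi * Complex.I * (j * k / (2 * m + 1))) *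
        (k * sqTerm m (ModularGroup.S • τ : ℍ) k) =
      (2 * Real.pi * Complex.I)⁻¹ * jacobiTheta₂' (j / (2 * m + 1)) (-1 / τ / (2 * m + 1)) := by
    rw [jacobiTheta₂', ← tsum_mul_left]
    refine tsum_congr fun k => ?_
    rw [jacobiTheta₂'_term, jacobiTheta₂_term_div, coe_S_smul]
    field_simp
  rw [← tsum_exp_mul_mul_sqTerm, hs, DThetaF_eq_jacobiTheta₂, jacobiTheta₂_functional_equation,
    jacobiTheta₂'_functional_equation]
  rw [show (j * (τ : ℂ)) / ((2 * m + 1) * τ) = j / (2 * m + 1) by field_simp,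
    show -1 / ((2 * m + 1) * (τ : ℂ)) = -1 / τ / (2 * m + 1) by field_simp]
  have he : Complex.exp (Real.pi * Complex.I * j ^ 2 / (2 * m + 1) * τ) *
      Complex.exp (-Real.pi * Complex.I * (j * τ) ^ 2 / ((2 * m + 1) * τ)) = 1 := by
    rw [← Complex.exp_add, ← Complex.exp_zero]
    congr 1
    field_simp
    ring
  generalize Complex.exp (Real.pi * Complex.I * j ^ 2 / (2 * m + 1) * τ) = E at *
  generalize Complex.exp (-Real.pi * Complex.I * (j * τ) ^ 2 / ((2 * m + 1) * τ)) = E' at *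
  generalize jacobiTheta₂' _ _ = J'
  generalize jacobiTheta₂ _ _ = J
  generalize 1 / (-Complex.I * ((2 * m + 1) * (τ : ℂ))) ^ (1 / 2 : ℂ) = c
  have h : ((2 * m + 1) / (2 * Real.pi * Complex.I) * (c * E' / ((2 * m + 1) * τ) *
      (J' - 2 * Real.pi * Complex.I * (j * τ) * J)) + j * (c * E' * J)) =
      E' * (c / τ * ((2 * Real.pi * Complex.I)⁻¹ * J')) := by
    field_simp
    ring
  rw [h, ← mul_assoc, he, one_mul]

theorem int_residue_induction (m : ℕ) {P : ℤ → Prop}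
    (hper : ∀ k, P k → P (k + (2 * m + 1))) (hneg : ∀ k, P k → P (-k)) (h0 : P 0)
    (hi : ∀ i : Fin m, P ((m : ℤ) - (i : ℕ))) (k : ℤ) : P k := by
  have hnat (n : ℕ) : P n := by
    induction n using Nat.strong_induction_on with
    | _ n ih =>
    rcases Nat.eq_zero_or_pos n with rfl | hn
    · exact h0
    rcases le_or_gt n m with hnm | hnm
    · have := hi ⟨m - n, by omega⟩
      rwa [show (m : ℤ) - ((m - n : ℕ) : ℤ) = n by omega] at this
    rcases le_or_gt n (2 * m) with hn2 | hn2
    · have := hper _ (hneg _ (ih (2 * m + 1 - n) (by omega)))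
      rwa [show -((2 * m + 1 - n : ℕ) : ℤ) + (2 * m + 1) = n by omega] at this
    · have := hper _ (ih (n - (2 * m + 1)) (by omega))
      rwa [show ((n - (2 * m + 1) : ℕ) : ℤ) + (2 * m + 1) = n by omega] at this
  obtain ⟨n, rfl | rfl⟩ := k.eq_nat_or_neg
  · exact hnat n
  · exact hneg _ (hnat n)

theorem ThetaF_add (m : ℕ) (k : ℤ) : ThetaF m (k + (2 * m + 1)) = ThetaF m k := by
  funext τ
  rw [ThetaF_eq, ThetaF_eq, ← (Equiv.addRight (1 : ℤ)).tsum_eq (fun n => sqTerm m τ (_ + k))]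
  refine tsum_congr fun n => ?_
  simp only [Equiv.coe_addRight]
  congr 1
  ring

theorem DThetaF_add (m : ℕ) (k : ℤ) : DThetaF m (k + (2 * m + 1)) = DThetaF m k := by
  funext τ
  rw [DThetaF_eq, DThetaF_eq,
    ← (Equiv.addRight (1 : ℤ)).tsum_eq (fun n => ((_ + k : ℤ) : ℂ) * sqTerm m τ (_ + k))]
  refine tsum_congr fun n => ?_
  simp only [Equiv.coe_addRight]
  rw [show (2 * m + 1) * n + (k + (2 * m + 1)) = (2 * m + 1) * (n + 1) + k by ring]

theorem sqTerm_neg (m : ℕ) (τ : ℂ) (k : ℤ) : sqTerm m τ (-k) = sqTerm m τ k := by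
  simp [sqTerm]

theorem ThetaF_neg (m : ℕ) (k : ℤ) : ThetaF m (-k) = ThetaF m k := by
  funext τ
  rw [ThetaF_eq, ThetaF_eq, ← (Equiv.neg ℤ).tsum_eq]
  refine tsum_congr fun n => ?_
  rw [Equiv.neg_apply, ← sqTerm_neg]
  congr 1
  ring

theorem DThetaF_neg (m : ℕ) (k : ℤ) (τ : ℍ) : DThetaF m (-k) τ = -DThetaF m k τ := by
  rw [DThetaF_eq, DThetaF_eq, ← (Equiv.neg ℤ).tsum_eq, ← tsum_neg]
  refine tsum_congr fun n => ?_
  rw [Equiv.neg_apply, show (2 * m + 1) * -n + -k = -((2 * m + 1) * n + k) by ring, sqTerm_neg,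
    Int.cast_neg, neg_mul]

theorem DThetaF_zero (m : ℕ) (τ : ℍ) : DThetaF m 0 τ = 0 := by
  have := DThetaF_neg m 0 τ
  rw [neg_zero] at this
  linear_combination this / 2

theorem webF_div_etaF_S_smul (m : ℕ) (τ : ℍ) :
    webF (ModularGroup.S • τ) / etaF (ModularGroup.S • τ) *
      (1 / (-Complex.I * ((2 * m + 1) * (ModularGroup.S • τ : ℍ))) ^ (1 / 2 : ℂ)) =
    1 / ((2 * m + 1 : ℝ) : ℂ) ^ (1 / 2 : ℂ) * (webF τ / etaF τ) := by
  have h := etaF_S_smul (ModularGroup.S • τ)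
  rw [S_smul_S_smul] at h
  have hc : (-Complex.I * ((2 * m + 1) * (ModularGroup.S • τ : ℍ))) ^ (1 / 2 : ℂ) =
      ((2 * m + 1 : ℝ) : ℂ) ^ (1 / 2 : ℂ) *
        (-Complex.I * (ModularGroup.S • τ : ℍ)) ^ (1 / 2 : ℂ) := by
    rw [← ofReal_mul_cpow (by positivity)]
    congr 1
    push_cast
    ring
  rw [webF_S_smul, hc, h, div_mul_div_comm, div_mul_div_comm]
  congr 1 <;> ring

section Span

variable (m : ℕ)

theorem theta_S_smul (j : ℤ) (τ : ℍ) :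
    webF (ModularGroup.S • τ) / etaF (ModularGroup.S • τ) * ThetaF m j (ModularGroup.S • τ) =
      ∑ r ∈ Finset.range (2 * m + 1), (1 / ((2 * m + 1 : ℝ) : ℂ) ^ (1 / 2 : ℂ) *
        Complex.exp (2 * Real.pi * Complex.I * (j * r / (2 * m + 1)))) *
          (webF τ / etaF τ * ThetaF m r τ) := by
  rw [ThetaF_eq_sum, S_smul_S_smul, ← mul_assoc, webF_div_etaF_S_smul, Finset.mul_sum]
  exact Finset.sum_congr rfl fun r _ => by ring

theorem dtheta_S_smul (j : ℤ) (τ : ℍ) :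
    webF (ModularGroup.S • τ) / etaF (ModularGroup.S • τ) * DThetaF m j (ModularGroup.S • τ) =
      ∑ r ∈ Finset.range (2 * m + 1), (-(1 / ((2 * m + 1 : ℝ) : ℂ) ^ (1 / 2 : ℂ)) *
        Complex.exp (2 * Real.pi * Complex.I * (j * r / (2 * m + 1)))) *
          (τ * (webF τ / etaF τ) * DThetaF m r τ) := by
  rw [DThetaF_eq_sum, S_smul_S_smul, ← mul_assoc, ← mul_div_assoc, webF_div_etaF_S_smul,
    Finset.mul_sum, coe_S_smul]
  refine Finset.sum_congr rfl fun r _ => ?_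
  have := τ.ne_zero
  field_simp

theorem sqTerm_two_vadd (j n : ℤ) (τ : ℍ) :
    sqTerm m ((2 : ℝ) +ᵥ τ : ℍ) ((2 * m + 1) * n + j) =
      Complex.exp (2 * Real.pi * Complex.I * (j * j / (2 * m + 1))) *
        sqTerm m τ ((2 * m + 1) * n + j) := by
  have hN := two_mul_add_one_ne_zero m
  have h := Complex.exp_int_mul_two_pi_mul_I ((2 * m + 1) * n ^ 2 + 2 * n * j)
  refine Eq.trans ?_ ((congrArg (_ * ·) h).trans (mul_one _))
  rw [sqTerm, sqTerm, ← Complex.exp_add, ← Complex.exp_add, UpperHalfPlane.coe_vadd]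
  congr 1
  push_cast
  field_simp
  ring

theorem ThetaF_two_vadd (j : ℤ) (τ : ℍ) : ThetaF m j ((2 : ℝ) +ᵥ τ) =
    Complex.exp (2 * Real.pi * Complex.I * (j * j / (2 * m + 1))) * ThetaF m j τ := by
  rw [ThetaF_eq, ThetaF_eq, ← tsum_mul_left]
  exact tsum_congr fun n => sqTerm_two_vadd m j n τ

theorem DThetaF_two_vadd (j : ℤ) (τ : ℍ) : DThetaF m j ((2 : ℝ) +ᵥ τ) =
    Complex.exp (2 * Real.pi * Complex.I * (j * j / (2 * m + 1))) * DThetaF m j τ := by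
  rw [DThetaF_eq, DThetaF_eq, ← tsum_mul_left]
  refine tsum_congr fun n => ?_
  rw [sqTerm_two_vadd]
  ring

/-- The span of the family `fam m`. -/
abbrev famSpan : Submodule ℂ (ℍ → ℂ) := Submodule.span ℂ (Set.range (fam m))

theorem fam_mem (i) : fam m i ∈ famSpan m := Submodule.subset_span ⟨i, rfl⟩

theorem theta_mem (k : ℤ) : (fun τ : ℍ => webF τ / etaF τ * ThetaF m k τ) ∈ famSpan m := by
  induction k using int_residue_induction m with
  | hper k ih => rwa [ThetaF_add]
  | hneg k ih => rwa [ThetaF_neg]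
  | h0 => exact fam_mem m (Sum.inl ())
  | hi i =>
    convert add_mem (fam_mem m (Sum.inr (Sum.inl i))) (fam_mem m (Sum.inr (Sum.inr (Sum.inl i))))
      using 1
    funext τ
    have hN := two_mul_add_one_ne_zero m
    simp only [Pi.add_apply, fam]
    field_simp
    ring

theorem dtheta_mem (k : ℤ) : (fun τ : ℍ => webF τ / etaF τ * DThetaF m k τ) ∈ famSpan m := by
  induction k using int_residue_induction m with
  | hper k ih => rwa [DThetaF_add]
  | hneg k ih =>
    simp only [DThetaF_neg, mul_neg]
    exact neg_mem ih
  | h0 =>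
    simp only [DThetaF_zero, mul_zero]
    exact zero_mem _
  | hi i =>
    convert sub_mem
      (Submodule.smul_mem _ ((2 * (m : ℂ) + 1) / 2) (fam_mem m (Sum.inr (Sum.inl i))))
      (Submodule.smul_mem _ ((2 * ((i : ℕ) : ℂ) + 1) / 2) (theta_mem m ((m : ℤ) - (i : ℕ))))
      using 1
    funext τ
    have hN := two_mul_add_one_ne_zero m
    simp only [Pi.sub_apply, Pi.smul_apply, smul_eq_mul, fam]
    field_simp
    ring

theorem tau_dtheta_mem (k : ℤ) :
    (fun τ : ℍ => (τ : ℂ) * (webF τ / etaF τ) * DThetaF m k τ) ∈ famSpan m := by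
  induction k using int_residue_induction m with
  | hper k ih => rwa [DThetaF_add]
  | hneg k ih =>
    simp only [DThetaF_neg, mul_neg]
    exact neg_mem ih
  | h0 =>
    simp only [DThetaF_zero, mul_zero]
    exact zero_mem _
  | hi i => exact fam_mem m (Sum.inr (Sum.inr (Sum.inr i)))

theorem comp_mem_of_generators {φ : ℍ → ℍ}
    (hθ : ∀ j, (fun τ => webF (φ τ) / etaF (φ τ) * ThetaF m j (φ τ)) ∈ famSpan m)
    (hd : ∀ j, (fun τ => webF (φ τ) / etaF (φ τ) * DThetaF m j (φ τ)) ∈ famSpan m)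
    (htd : ∀ j, (fun τ => (φ τ : ℂ) * (webF (φ τ) / etaF (φ τ)) * DThetaF m j (φ τ)) ∈ famSpan m)
    (f) (hf : f ∈ famSpan m) : (fun τ => f (φ τ)) ∈ famSpan m := by
  suffices h : famSpan m ≤ Submodule.comap (LinearMap.funLeft ℂ ℂ φ) (famSpan m) from h hf
  rw [Submodule.span_le]
  rintro _ ⟨i, rfl⟩
  change (fun τ => fam m i (φ τ)) ∈ famSpan m
  rcases i with _ | i | i | i
  · exact hθ 0
  · convert add_mem
      (Submodule.smul_mem _ ((2 * ((i : ℕ) : ℂ) + 1) / (2 * (m : ℂ) + 1)) (hθ (m - (i : ℕ))))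
      (Submodule.smul_mem _ (2 / (2 * (m : ℂ) + 1)) (hd (m - (i : ℕ)))) using 1
    funext τ
    simp only [Pi.add_apply, Pi.smul_apply, smul_eq_mul, fam]
    ring
  · convert sub_mem
      (Submodule.smul_mem _ ((2 * (m : ℂ) - 2 * ((i : ℕ) : ℂ)) / (2 * (m : ℂ) + 1))
        (hθ (m - (i : ℕ))))
      (Submodule.smul_mem _ (2 / (2 * (m : ℂ) + 1)) (hd (m - (i : ℕ)))) using 1
    funext τ
    simp only [Pi.sub_apply, Pi.smul_apply, smul_eq_mul, fam]
    ring
  · exact htd _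

theorem sum_smul_mem {s : Finset ℕ} {a : ℕ → ℂ} {F : ℕ → ℍ → ℂ} (h : ∀ r, F r ∈ famSpan m) :
    (fun τ => ∑ r ∈ s, a r * F r τ) ∈ famSpan m := by
  convert Submodule.sum_mem (famSpan m) (t := s) fun r _ => Submodule.smul_mem _ (a r) (h r) using 1
  funext τ
  simp

theorem comp_S_mem (f) (hf : f ∈ famSpan m) :
    (fun τ : ℍ => f (ModularGroup.S • τ)) ∈ famSpan m := by
  refine comp_mem_of_generators m (fun j => ?_) (fun j => ?_) (fun j => ?_) f hf
  · simp only [theta_S_smul]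
    exact sum_smul_mem m fun r => theta_mem m r
  · simp only [dtheta_S_smul]
    exact sum_smul_mem m fun r => tau_dtheta_mem m r
  · simp only [mul_assoc ((ModularGroup.S • _ : ℍ) : ℂ), dtheta_S_smul]
    convert sum_smul_mem m (s := Finset.range (2 * m + 1))
      (a := fun r => 1 / ((2 * m + 1 : ℝ) : ℂ) ^ (1 / 2 : ℂ) *
        Complex.exp (2 * Real.pi * Complex.I * (j * r / (2 * m + 1))))
      fun r => dtheta_mem m r using 1
    funext τ
    rw [Finset.mul_sum]
    refine Finset.sum_congr rfl fun r _ => ?_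
    have := τ.ne_zero
    rw [coe_S_smul]
    field_simp

theorem comp_two_vadd_mem (f) (hf : f ∈ famSpan m) :
    (fun τ : ℍ => f ((2 : ℝ) +ᵥ τ)) ∈ famSpan m := by
  refine comp_mem_of_generators m (fun j => ?_) (fun j => ?_) (fun j => ?_) f hf
  · simp only [webF_div_etaF_two_vadd, ThetaF_two_vadd]
    convert Submodule.smul_mem _ (Complex.exp (-(Real.pi * Complex.I / 4)) *
      Complex.exp (2 * Real.pi * Complex.I * (j * j / (2 * m + 1)))) (theta_mem m j) using 1
    funext τ
    simp only [Pi.smul_apply, smul_eq_mul]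
    ring
  · simp only [webF_div_etaF_two_vadd, DThetaF_two_vadd]
    convert Submodule.smul_mem _ (Complex.exp (-(Real.pi * Complex.I / 4)) *
      Complex.exp (2 * Real.pi * Complex.I * (j * j / (2 * m + 1)))) (dtheta_mem m j) using 1
    funext τ
    simp only [Pi.smul_apply, smul_eq_mul]
    ring
  · simp only [webF_div_etaF_two_vadd, DThetaF_two_vadd]
    convert Submodule.smul_mem _ (Complex.exp (-(Real.pi * Complex.I / 4)) *
      Complex.exp (2 * Real.pi * Complex.I * (j * j / (2 * m + 1))))
      (add_mem (tau_dtheta_mem m j) (Submodule.smul_mem _ 2 (dtheta_mem m j))) using 1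
    funext τ
    simp only [Pi.add_apply, Pi.smul_apply, smul_eq_mul, UpperHalfPlane.coe_vadd]
    push_cast
    ring

end Span

theorem sqTerm_vadd_period (m : ℕ) (k : ℤ) (τ : ℍ) :
    sqTerm m ((2 * (2 * m + 1) : ℝ) +ᵥ τ : ℍ) k = sqTerm m τ k := by
  have hN := two_mul_add_one_ne_zero m
  rw [← mul_one (sqTerm m τ k), ← Complex.exp_int_mul_two_pi_mul_I (k ^ 2), sqTerm, sqTerm,
    ← Complex.exp_add, UpperHalfPlane.coe_vadd]
  congr 1
  push_cast
  field_simp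
  ring

theorem ThetaF_vadd_period (m : ℕ) (j : ℤ) (τ : ℍ) :
    ThetaF m j ((2 * (2 * m + 1) : ℝ) +ᵥ τ) = ThetaF m j τ := by
  simp only [ThetaF_eq, sqTerm_vadd_period]

theorem DThetaF_vadd_period (m : ℕ) (j : ℤ) (τ : ℍ) :
    DThetaF m j ((2 * (2 * m + 1) : ℝ) +ᵥ τ) = DThetaF m j τ := by
  simp only [DThetaF_eq, sqTerm_vadd_period]

theorem tsum_sqTerm_eq_zero {m : ℕ} {u : ℤ → ℂ}
    (h : ∀ τ : ℍ, HasSum (fun k => u k * sqTerm m τ k) 0) :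
    u 0 = 0 ∧ ∀ k, u k + u (-k) = 0 := by
  have key : ∀ n : ℕ, (if n = 0 then u 0 else u n + u (-n)) = 0 := by
    refine hasSum_pow_eq_zero (e := fun n => n ^ 2)
      (fun a b hab => Nat.pow_lt_pow_left hab two_ne_zero) fun x hx hx1 => ?_
    have hy : 0 < -Real.log x * (2 * m + 1) / Real.pi :=
      div_pos (mul_pos (neg_pos.2 (Real.log_neg hx hx1)) (by positivity)) Real.pi_pos
    set τ : ℍ := ⟨((-Real.log x * (2 * m + 1) / Real.pi : ℝ) : ℂ) * Complex.I, by simpa using hy⟩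
      with hτ
    have hterm (k : ℤ) : sqTerm m τ k = (x : ℂ) ^ (k.natAbs ^ 2) := by
      have hx' : (x : ℂ) = Complex.exp (Real.log x) := by
        rw [← Complex.ofReal_exp, Real.exp_log hx]
      have hk : ((k.natAbs ^ 2 : ℕ) : ℂ) = (k : ℂ) ^ 2 := by
        have := congrArg (Int.cast : ℤ → ℂ) (Int.natAbs_sq k)
        rw [← Int.cast_natCast]
        push_cast at this ⊢
        exact this
      rw [hx', ← Complex.exp_nat_mul, hk, sqTerm]
      congr 1
      have := two_mul_add_one_ne_zero m
      have hpi : (Real.pi : ℂ) ≠ 0 := by exact_mod_cast Real.pi_ne_zero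
      change _ * (((-Real.log x * (2 * m + 1) / Real.pi : ℝ) : ℂ) * Complex.I) = _
      push_cast
      field_simp
      linear_combination (-(k : ℂ) ^ 2 * (Real.log x : ℝ)) * Complex.I_sq
    have hs := (h τ).nat_add_neg
    simp only [hterm] at hs
    have hs' := hs.sub (hasSum_ite_eq 0 (u 0))
    simp only [Int.natAbs_zero, zero_pow two_ne_zero, pow_zero, mul_one, zero_add, sub_self] at hs'
    refine hs'.congr_fun fun n => ?_
    rcases eq_or_ne n 0 with rfl | hn
    · simp
    · simp [hn]
      ring
  refine ⟨by simpa using key 0, fun k => ?_⟩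
  obtain ⟨n, rfl | rfl⟩ := k.eq_nat_or_neg
  all_goals
    rcases Nat.eq_zero_or_pos n with rfl | hn
    · have := key 0
      simp_all
    · have := key n
      rw [if_neg hn.ne'] at this
      simpa [add_comm] using this

theorem hasSum_ite_mul_sqTerm {m : ℕ} {τ : ℍ} {w : ℤ → ℂ}
    (hw : Summable fun k => w k * sqTerm m τ k) (j : ℤ) :
    HasSum (fun k => (if (2 * m + 1 : ℤ) ∣ k - j then w k else 0) * sqTerm m τ k)
      (∑' n : ℤ, w ((2 * m + 1) * n + j) * sqTerm m τ ((2 * m + 1) * n + j)) := by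
  have hinj : Function.Injective fun n : ℤ => (2 * m + 1) * n + j := fun a b hab =>
    mul_left_cancel₀ (by omega : (2 * m + 1 : ℤ) ≠ 0) (add_right_cancel hab)
  refine (hinj.hasSum_iff fun k hk => ?_).1 ((hw.comp_injective hinj).hasSum.congr_fun fun n => ?_)
  · rw [if_neg, zero_mul]
    rintro ⟨n, hn⟩
    exact hk ⟨n, by simp only; omega⟩
  · simp

theorem hasSum_theta {m : ℕ} (a : ℂ) (j : ℤ) (τ : ℍ) :
    HasSum (fun k => (if (2 * m + 1 : ℤ) ∣ k - j then a else 0) * sqTerm m τ k)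
      (a * ThetaF m j τ) := by
  rw [ThetaF_eq, ← tsum_mul_left]
  exact hasSum_ite_mul_sqTerm (w := fun _ => a) ((summable_sqTerm m τ).mul_left _) j

theorem hasSum_dtheta {m : ℕ} (a : ℂ) (j : ℤ) (τ : ℍ) :
    HasSum (fun k => (if (2 * m + 1 : ℤ) ∣ k - j then a * k else 0) * sqTerm m τ k)
      (a * DThetaF m j τ) := by
  have h := (summable_mul_sqTerm m τ).mul_left a
  simp only [← mul_assoc] at h
  rw [DThetaF_eq, ← tsum_mul_left]
  simp only [← mul_assoc]
  exact hasSum_ite_mul_sqTerm (w := fun k => a * k) h j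

theorem theta_coeff_eq_zero {m : ℕ} {a : ℂ} {b c : Fin m → ℂ}
    (h : ∀ τ : ℍ, a * ThetaF m 0 τ + ∑ i : Fin m, (b i * ThetaF m ((m : ℤ) - (i : ℕ)) τ +
      c i * DThetaF m ((m : ℤ) - (i : ℕ)) τ) = 0) : a = 0 ∧ ∀ i, b i = 0 ∧ c i = 0 := by
  set u : ℤ → ℂ := fun k => (if (2 * m + 1 : ℤ) ∣ k - 0 then a else 0) +
    ∑ i : Fin m, if (2 * m + 1 : ℤ) ∣ k - ((m : ℤ) - (i : ℕ)) then b i + c i * k else 0 with hu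
  have hsum (τ : ℍ) : HasSum (fun k => u k * sqTerm m τ k) 0 := by
    rw [← h τ]
    simp only [hu, add_mul, Finset.sum_mul]
    refine (hasSum_theta a 0 τ).add (hasSum_sum fun i _ => ?_)
    refine ((hasSum_theta (b i) _ τ).add (hasSum_dtheta (c i) _ τ)).congr_fun fun k => ?_
    split_ifs <;> ring
  obtain ⟨h0, hk⟩ := tsum_sqTerm_eq_zero hsum
  have hdvd {x : ℤ} (hx : (2 * m + 1 : ℤ) ∣ x) (hlt : |x| < 2 * m + 1) : x = 0 :=
    Int.eq_zero_of_abs_lt_dvd hx hlt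
  have hpos (i : Fin m) (k : ℤ) (hki : (2 * m + 1 : ℤ) ∣ k - ((m : ℤ) - (i : ℕ))) :
      u k = b i + c i * k := by
    have hi := i.2
    simp only [hu]
    rw [if_neg, Finset.sum_eq_single i, if_pos hki, zero_add]
    · intro l _ hl
      refine if_neg fun hkl => hl (Fin.ext ?_)
      have := hdvd (dvd_sub hki hkl) (by rw [abs_lt]; omega)
      omega
    · simp
    · intro hd
      have := hdvd (dvd_sub hd hki) (by rw [abs_lt]; omega)
      omega
  have hneg (i : Fin m) (k : ℤ) (hki : (2 * m + 1 : ℤ) ∣ k + ((m : ℤ) - (i : ℕ))) :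
      u k = 0 := by
    have hi := i.2
    simp only [hu]
    rw [if_neg, Finset.sum_eq_zero, zero_add]
    · intro l _
      refine if_neg fun hkl => ?_
      have := hdvd (dvd_sub hki hkl) (by rw [abs_lt]; omega)
      omega
    · intro hd
      have := hdvd (dvd_sub hki hd) (by rw [abs_lt]; omega)
      omega
  have hrel (i : Fin m) (k : ℤ) (hki : (2 * m + 1 : ℤ) ∣ k - ((m : ℤ) - (i : ℕ))) :
      b i + c i * k = 0 := by
    have := hk k
    rwa [hpos i k hki, hneg i (-k) (by
      rwa [show -k + ((m : ℤ) - (i : ℕ)) = -(k - ((m : ℤ) - (i : ℕ))) by ring, dvd_neg]),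
      add_zero] at this
  refine ⟨?_, fun i => ?_⟩
  · simp only [hu] at h0
    rwa [if_pos (by simp), Finset.sum_eq_zero, add_zero] at h0
    intro i _
    refine if_neg fun hd => ?_
    have hi := i.2
    have := hdvd hd (by rw [abs_lt]; omega)
    omega
  · have h1 := hrel i ((m : ℤ) - (i : ℕ)) (by simp)
    have h2 := hrel i ((m : ℤ) - (i : ℕ) + (2 * m + 1)) (by simp)
    have hN := two_mul_add_one_ne_zero m
    push_cast at h1 h2
    have hc : c i = 0 := by
      refine (mul_eq_zero.1 (?_ : c i * (2 * (m : ℂ) + 1) = 0)).resolve_right hN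
      linear_combination h2 - h1
    refine ⟨?_, hc⟩
    simpa [hc] using h1

theorem linearIndependent_fam (m : ℕ) : LinearIndependent ℂ (fam m) := by
  rw [Fintype.linearIndependent_iff]
  intro g hg
  have hN := two_mul_add_one_ne_zero m
  set α : Fin m → ℂ := fun i => g (Sum.inr (Sum.inl i)) with hα
  set β : Fin m → ℂ := fun i => g (Sum.inr (Sum.inr (Sum.inl i))) with hβ
  set γ : Fin m → ℂ := fun i => g (Sum.inr (Sum.inr (Sum.inr i))) with hγ
  set b : Fin m → ℂ := fun i => (α i * (2 * ((i : ℕ) : ℂ) + 1) +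
    β i * (2 * (m : ℂ) - 2 * ((i : ℕ) : ℂ))) / (2 * (m : ℂ) + 1) with hb
  set c : Fin m → ℂ := fun i => 2 * (α i - β i) / (2 * (m : ℂ) + 1) with hc
  have hrel (τ : ℍ) : g (Sum.inl ()) * ThetaF m 0 τ +
      ∑ i : Fin m, (b i * ThetaF m ((m : ℤ) - (i : ℕ)) τ +
        c i * DThetaF m ((m : ℤ) - (i : ℕ)) τ) +
      τ * ∑ i : Fin m, γ i * DThetaF m ((m : ℤ) - (i : ℕ)) τ = 0 := by
    have hne : webF τ / etaF τ ≠ 0 := div_ne_zero (webF_ne_zero τ) (etaF_ne_zero τ)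
    refine (mul_eq_zero.1 (?_ : webF τ / etaF τ * _ = 0)).resolve_left hne
    have := congrFun hg τ
    simp only [Fintype.sum_sum_type, Finset.univ_unique, Finset.sum_singleton,
      Finset.sum_apply, Pi.smul_apply, smul_eq_mul, fam, Pi.zero_apply] at this
    rw [← this, mul_add, mul_add, Finset.mul_sum, Finset.mul_sum, Finset.mul_sum, add_assoc,
      ← Finset.sum_add_distrib, ← Finset.sum_add_distrib, ← Finset.sum_add_distrib]
    congr 1
    · change _ * (g (Sum.inl ()) * _) = g (Sum.inl ()) * _
      ring
    · refine Finset.sum_congr rfl fun i _ => ?_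
      simp only [hb, hc, hα, hβ, hγ]
      ring
  have hγ0 : ∀ i, γ i = 0 := by
    refine fun i => (theta_coeff_eq_zero (a := 0) (b := 0) (c := γ) (fun τ => ?_)).2 i |>.2
    have h1 := hrel τ
    have h2 := hrel ((2 * (2 * m + 1) : ℝ) +ᵥ τ)
    simp only [ThetaF_vadd_period, DThetaF_vadd_period, UpperHalfPlane.coe_vadd] at h2
    simp only [Pi.zero_apply, zero_mul, zero_add]
    refine (mul_eq_zero.1 (?_ : (2 * (2 * (m : ℂ) + 1)) * _ = 0)).resolve_left
      (mul_ne_zero two_ne_zero hN)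
    push_cast at h2
    linear_combination h2 - h1
  obtain ⟨ha, hbc⟩ := theta_coeff_eq_zero (a := g (Sum.inl ())) (b := b) (c := c) fun τ => by
    simpa [hγ0] using hrel τ
  have hαβ (i : Fin m) : α i = β i := by
    have := (hbc i).2
    simp only [hc, div_eq_zero_iff, hN, or_false, mul_eq_zero, two_ne_zero, false_or] at this
    exact sub_eq_zero.1 this
  have hβ0 (i : Fin m) : β i = 0 := by
    have := (hbc i).1
    simp only [hb, hαβ, div_eq_zero_iff, hN, or_false] at this
    refine (mul_eq_zero.1 (?_ : β i * (2 * (m : ℂ) + 1) = 0)).resolve_right hN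
    linear_combination this
  rintro (_ | i | i | i)
  · exact ha
  · exact (hαβ i).trans (hβ0 i)
  · exact hβ0 i
  · exact hγ0 i

/-- the `3m+1` functions `F₀`, `A_i`, `B_i` (`0 ≤ i ≤ m-1`) and `C_i`
(`0 ≤ i ≤ m-1`) are linearly independent over `ℂ`, and their span is invariant under
`F(τ) ↦ F(-1/τ)` (the action of `S = ModularGroup.S`) and `F(τ) ↦ F(τ+2)`; i.e. the
span is a `(3m+1)`-dimensional `Γ_θ`-invariant space. -/
theorem stmt_16 (m : ℕ) (hm : 1 ≤ m) :
    LinearIndependent ℂ (fam m)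
      ∧ (∀ f, f ∈ Submodule.span ℂ (Set.range (fam m)) →
          (fun τ : ℍ => f (ModularGroup.S • τ)) ∈ Submodule.span ℂ (Set.range (fam m)))
      ∧ (∀ f, f ∈ Submodule.span ℂ (Set.range (fam m)) →
          (fun τ : ℍ => f ((2 : ℝ) +ᵥ τ)) ∈ Submodule.span ℂ (Set.range (fam m))) := by
  exact ⟨linearIndependent_fam m, comp_S_mem m, comp_two_vadd_mem m⟩
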